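/- For every integer k ≥ 0, the total number of chains of length k starting at the empty composition, i.e. sequences () = λ^0 → λ^1 → ⋯ → λ^k of compositions with λ^i → λ^{i+1} for all 0 ≤ i < k, equals the number of set partitions of [k] (the k-th Bell number). -/

import Mathlib

/-- `P` is a set partition of `[k] = {1,…,k}`: its blocks are nonempty,
pairwise disjoint, and their union is `{1,…,k}`. -/
def IsSetPartition (k : ℕ) (P : Finset (Finset ℕ)) : Prop :=
  (∀ b ∈ P, b.Nonempty) ∧
    (∀ b ∈ P, ∀ c ∈ P, b ≠ c → Disjoint b c) ∧
    P.sup id = Finset.Icc 1 k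

/-- The shape of a set partition: the list of block sizes, blocks being listed
increasingly according to their largest element (normal ordering). -/
def shape (P : Finset (Finset ℕ)) : List ℕ :=
  (List.range ((P.sup fun b => b.sup id) + 1)).filterMap fun m =>
    let c := P.sup fun b => if m ∈ b ∧ ∀ x ∈ b, x ≤ m then b.card else 0
    if c = 0 then none else some c

/-- `Π⁻`: decrease every element of every block by `1`, delete the resulting
`0` from its block, and delete the block if it becomes empty. -/
def pminus (P : Finset (Finset ℕ)) : Finset (Finset ℕ) :=
  (P.image fun b => (b.image fun x => x - 1).erase 0).filter fun b => b.Nonempty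

/-- One-step relation on compositions (as lists of positive integers):
`λ → Λ` iff `Λ` is obtained from `λ` by increasing exactly one entry by `1`,
or by prepending a new first entry equal to `1`. -/
def Step (lam Lam : List ℕ) : Prop :=
  Lam = 1 :: lam ∨ ∃ j : Fin lam.length, Lam = lam.set j (lam.get j + 1)

/-- The successors of a composition: `none` prepends a new entry `1`, and `some j` increases
the entry in position `j`. -/
def successor (l : List ℕ) : Option (Fin l.length) → List ℕ
  | none => 1 :: l
  | some j => l.set j (l.get j + 1)

theorem step_iff_exists_successor {l L : List ℕ} : Step l L ↔ ∃ o, successor l o = L := by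
  simp only [Step, Option.exists, successor, eq_comm]

theorem successor_injective (l : List ℕ) : Function.Injective (successor l) := by
  rintro (_ | i) (_ | j) h
  · rfl
  · simpa [successor] using congrArg List.length h
  · simpa [successor] using congrArg List.length h
  · by_contra hij
    have hne : (j : ℕ) ≠ i := fun e => hij (congrArg some (Fin.ext e.symm))
    have hi := congrArg (fun L : List ℕ => L[(i : ℕ)]?) h
    simp [successor, hne] at hi

/-- Chains of length `k` of compositions, starting at the empty composition. -/
abbrev CompositionChain (k : ℕ) : Type :=
  {c : Fin (k + 1) → List ℕ // c 0 = [] ∧ ∀ i : Fin k, Step (c i.castSucc) (c i.succ)}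

/-- The final composition of a chain. -/
def CompositionChain.last {k : ℕ} (c : CompositionChain k) : List ℕ := c.1 (Fin.last k)

/-- Extend a chain by a successor of its final composition. -/
def CompositionChain.extend {k : ℕ}
    (x : Σ c : CompositionChain k, Option (Fin c.last.length)) : CompositionChain (k + 1) :=
  ⟨Fin.snoc (α := fun _ => List ℕ) x.1.1 (successor x.1.last x.2), by
    refine ⟨?_, fun i => ?_⟩
    · exact (Fin.snoc_castSucc (α := fun _ => List ℕ) _ _ (0 : Fin (k + 1))).trans x.1.2.1
    · induction i using Fin.lastCases with
      | last =>
        rw [Fin.snoc_castSucc, Fin.succ_last, Fin.snoc_last]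
        exact step_iff_exists_successor.2 ⟨x.2, rfl⟩
      | cast i =>
        rw [Fin.snoc_castSucc, Fin.succ_castSucc, Fin.snoc_castSucc]
        exact x.1.2.2 i⟩

theorem CompositionChain.last_extend {k : ℕ}
    (x : Σ c : CompositionChain k, Option (Fin c.last.length)) :
    (extend x).last = successor x.1.last x.2 := by
  simp [last, extend]

theorem CompositionChain.extend_bijective (k : ℕ) :
    Function.Bijective (extend (k := k)) := by
  constructor
  · rintro ⟨c, o⟩ ⟨d, p⟩ h
    have hval := congrArg Subtype.val h
    have hcd : c = d := Subtype.ext (by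
      have := congrArg (Fin.init (α := fun _ => List ℕ)) hval
      simpa [extend] using this)
    subst hcd
    have hlast := congrArg last h
    rw [last_extend, last_extend] at hlast
    exact congrArg (Sigma.mk c) (successor_injective _ hlast)
  · rintro ⟨c, h0, hc⟩
    obtain ⟨o, ho⟩ := step_iff_exists_successor.1 (hc (Fin.last k))
    refine ⟨⟨⟨Fin.init (α := fun _ => List ℕ) c, h0, fun i => hc i.castSucc⟩, o⟩, ?_⟩
    apply Subtype.ext
    refine Eq.trans ?_ (Fin.snoc_init_self c)
    exact congrArg (Fin.snoc (α := fun _ => List ℕ) (Fin.init (α := fun _ => List ℕ) c)) ho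

instance CompositionChain.finite (k : ℕ) : Finite (CompositionChain k) := by
  induction k with
  | zero =>
    refine @Finite.of_subsingleton _ ⟨fun c d => Subtype.ext (funext fun i => ?_)⟩
    rw [Fin.fin_one_eq_zero i, c.2.1, d.2.1]
  | succ k ih => exact Finite.of_surjective _ (extend_bijective k).2

/-- The set partitions of `{1,…,k}`. -/
abbrev SetPartition (k : ℕ) : Type := {P : Finset (Finset ℕ) // IsSetPartition k P}

theorem IsSetPartition.mem_Icc {k : ℕ} {P : Finset (Finset ℕ)} (h : IsSetPartition k P)
    {b : Finset ℕ} (hb : b ∈ P) {x : ℕ} (hx : x ∈ b) : 1 ≤ x ∧ x ≤ k := by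
  have : x ∈ P.sup id := Finset.mem_sup.2 ⟨b, hb, hx⟩
  rwa [h.2.2, Finset.mem_Icc] at this

theorem IsSetPartition.exists_mem {k : ℕ} {P : Finset (Finset ℕ)} (h : IsSetPartition k P)
    {x : ℕ} (h1 : 1 ≤ x) (hk : x ≤ k) : ∃ b ∈ P, x ∈ b := by
  have : x ∈ P.sup id := by rw [h.2.2, Finset.mem_Icc]; exact ⟨h1, hk⟩
  exact Finset.mem_sup.1 this

theorem IsSetPartition.eq_of_mem {k : ℕ} {P : Finset (Finset ℕ)} (h : IsSetPartition k P)
    {b c : Finset ℕ} (hb : b ∈ P) (hc : c ∈ P) {x : ℕ} (hxb : x ∈ b) (hxc : x ∈ c) : b = c := by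
  by_contra hne
  exact Finset.disjoint_left.1 (h.2.1 b hb c hc hne) hxb hxc

theorem isSetPartition_iff {k : ℕ} {P : Finset (Finset ℕ)} : IsSetPartition k P ↔
    (∀ b ∈ P, b.Nonempty) ∧ (∀ b ∈ P, ∀ c ∈ P, ∀ x, x ∈ b → x ∈ c → b = c) ∧
      ∀ x, (∃ b ∈ P, x ∈ b) ↔ 1 ≤ x ∧ x ≤ k := by
  refine ⟨fun h => ⟨h.1, fun b hb c hc x => h.eq_of_mem hb hc,
    fun x => ⟨fun ⟨b, hb, hx⟩ => h.mem_Icc hb hx, fun hx => h.exists_mem hx.1 hx.2⟩⟩, ?_⟩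
  rintro ⟨h1, h2, h3⟩
  refine ⟨h1, fun b hb c hc hne => Finset.disjoint_left.2 fun x hxb hxc =>
    hne (h2 b hb c hc x hxb hxc), ?_⟩
  ext x
  rw [Finset.mem_Icc, ← h3 x]
  simp [Finset.mem_sup]

/-- Adjoin `n` to the block `b`, where `b = ∅` stands for creating the new block `{n}`. -/
def adjoin (n : ℕ) (P : Finset (Finset ℕ)) (b : Finset ℕ) : Finset (Finset ℕ) :=
  insert (insert n b) (P.erase b)

theorem IsSetPartition.adjoin {k : ℕ} {P : Finset (Finset ℕ)} (h : IsSetPartition k P)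
    {b : Finset ℕ} (hb : b ∈ insert ∅ P) : IsSetPartition (k + 1) (adjoin (k + 1) P b) := by
  have hlt : ∀ c ∈ P, k + 1 ∉ c := fun c hc hx => by
    have := h.mem_Icc hc hx
    omega
  rw [isSetPartition_iff] at h ⊢
  obtain ⟨h1, h2, h3⟩ := h
  rw [Finset.mem_insert] at hb
  simp only [_root_.adjoin, Finset.mem_insert, Finset.mem_erase]
  refine ⟨?_, ?_, fun x => ⟨?_, ?_⟩⟩
  · rintro c (rfl | ⟨-, hc⟩)
    · exact Finset.insert_nonempty _ _
    · exact h1 c hc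
  · have key : ∀ c, c ≠ b → c ∈ P → ∀ x, x ∈ insert (k + 1) b → x ∉ c := by
      intro c hcb hc x hx hxc
      rcases Finset.mem_insert.1 hx with rfl | hxb
      · exact hlt c hc hxc
      · rcases hb with rfl | hb
        · simp at hxb
        · exact hcb (h2 c hc b hb x hxc hxb)
    rintro c (rfl | ⟨hcb, hc⟩) d (rfl | ⟨hdb, hd⟩) x hxc hxd
    · rfl
    · exact (key d hdb hd x hxc hxd).elim
    · exact (key c hcb hc x hxd hxc).elim
    · exact h2 c hc d hd x hxc hxd
  · rintro ⟨c, rfl | ⟨-, hc⟩, hx⟩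
    · rcases Finset.mem_insert.1 hx with rfl | hxb
      · omega
      · rcases hb with rfl | hb
        · simp at hxb
        · have := (h3 x).1 ⟨b, hb, hxb⟩
          omega
    · have := (h3 x).1 ⟨c, hc, hx⟩
      omega
  · rintro ⟨hx1, hxk⟩
    by_cases hx : x = k + 1
    · exact ⟨_, Or.inl rfl, hx ▸ Finset.mem_insert_self _ _⟩
    · obtain ⟨c, hc, hxc⟩ := (h3 x).2 ⟨hx1, by omega⟩
      by_cases hcb : c = b
      · exact ⟨_, Or.inl rfl, Finset.mem_insert_of_mem (hcb ▸ hxc)⟩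
      · exact ⟨c, Or.inr ⟨hcb, hc⟩, hxc⟩

/-- Adjoin `k + 1` to a block of a set partition of `{1,…,k}`, or to the empty block. -/
def SetPartition.extend {k : ℕ}
    (x : Σ P : SetPartition k, {b : Finset ℕ // b ∈ insert ∅ P.1}) : SetPartition (k + 1) :=
  ⟨adjoin (k + 1) x.1.1 x.2.1, x.1.2.adjoin x.2.2⟩

theorem IsSetPartition.empty_notMem {k : ℕ} {P : Finset (Finset ℕ)} (h : IsSetPartition k P) :
    ∅ ∉ P := fun he => by simpa using h.1 ∅ he

theorem IsSetPartition.succ_notMem {k : ℕ} {P : Finset (Finset ℕ)} (h : IsSetPartition k P)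
    {b : Finset ℕ} (hb : b ∈ insert ∅ P) : k + 1 ∉ b := fun hx => by
  rcases Finset.mem_insert.1 hb with rfl | hb
  · simp at hx
  · have := h.mem_Icc hb hx
    omega

theorem IsSetPartition.insert_succ_notMem {k : ℕ} {P : Finset (Finset ℕ)}
    (h : IsSetPartition k P) (b : Finset ℕ) : insert (k + 1) b ∉ P := fun hb =>
  h.succ_notMem (Finset.mem_insert_of_mem hb) (Finset.mem_insert_self _ _)

theorem IsSetPartition.erase_insert_erase_insert {k : ℕ} {P : Finset (Finset ℕ)}
    (h : IsSetPartition k P) {b : Finset ℕ} (hb : b ∈ insert ∅ P) :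
    (insert b ((_root_.adjoin (k + 1) P b).erase (insert (k + 1) b))).erase ∅ = P := by
  have hn : insert (k + 1) b ∉ P.erase b :=
    fun hm => h.insert_succ_notMem b (Finset.mem_of_mem_erase hm)
  rw [_root_.adjoin, Finset.erase_insert hn]
  rcases Finset.mem_insert.1 hb with rfl | hb
  · rw [Finset.erase_eq_of_notMem h.empty_notMem, Finset.erase_insert h.empty_notMem]
  · rw [Finset.insert_erase hb, Finset.erase_eq_of_notMem h.empty_notMem]

theorem SetPartition.extend_bijective (k : ℕ) : Function.Bijective (extend (k := k)) := by
  constructor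
  · rintro ⟨⟨P, hP⟩, b, hb⟩ ⟨⟨Q, hQ⟩, c, hc⟩ h
    have hval : adjoin (k + 1) P b = adjoin (k + 1) Q c := congrArg Subtype.val h
    have hins : insert (k + 1) b = insert (k + 1) c :=
      (hQ.adjoin hc).eq_of_mem (x := k + 1) (hval ▸ Finset.mem_insert_self _ _)
        (Finset.mem_insert_self _ _) (Finset.mem_insert_self _ _) (Finset.mem_insert_self _ _)
    have hbc : b = c := by
      rw [← Finset.erase_insert (hP.succ_notMem hb), hins, Finset.erase_insert (hQ.succ_notMem hc)]
    subst hbc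
    have hPQ : P = Q := by
      rw [← hP.erase_insert_erase_insert hb, hval, hQ.erase_insert_erase_insert hc]
    subst hPQ
    rfl
  · rintro ⟨Q, hQ⟩
    obtain ⟨B, hB, hkB⟩ := hQ.exists_mem (x := k + 1) (by omega) le_rfl
    have hbQ : B.erase (k + 1) ∉ Q := fun hb => by
      obtain ⟨x, hx⟩ := hQ.1 _ hb
      have hBe := hQ.eq_of_mem hb hB hx (Finset.mem_of_mem_erase hx)
      rw [← hBe] at hkB
      simp at hkB
    have hP : IsSetPartition k ((insert (B.erase (k + 1)) (Q.erase B)).erase ∅) := by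
      have hQ' := hQ
      rw [isSetPartition_iff] at hQ' ⊢
      obtain ⟨-, h2, h3⟩ := hQ'
      simp only [Finset.mem_insert, Finset.mem_erase]
      refine ⟨fun b hb => Finset.nonempty_iff_ne_empty.2 hb.1, ?_, fun x => ⟨?_, ?_⟩⟩
      · rintro c ⟨-, rfl | ⟨hcB, hc⟩⟩ d ⟨-, rfl | ⟨hdB, hd⟩⟩ x hxc hxd
        · rfl
        · exact (hdB (h2 d hd B hB x hxd (Finset.mem_of_mem_erase hxc))).elim
        · exact (hcB (h2 c hc B hB x hxc (Finset.mem_of_mem_erase hxd))).elim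
        · exact h2 c hc d hd x hxc hxd
      · rintro ⟨c, ⟨-, rfl | ⟨hcB, hc⟩⟩, hx⟩
        · have := (h3 x).1 ⟨B, hB, Finset.mem_of_mem_erase hx⟩
          have := Finset.ne_of_mem_erase hx
          omega
        · have := (h3 x).1 ⟨c, hc, hx⟩
          have : x ≠ k + 1 := fun e => hcB (h2 c hc B hB x hx (e ▸ hkB))
          omega
      · rintro ⟨hx1, hxk⟩
        obtain ⟨c, hc, hxc⟩ := (h3 x).2 ⟨hx1, by omega⟩
        by_cases hcB : c = B
        · have hx : x ∈ B.erase (k + 1) := Finset.mem_erase.2 ⟨by omega, hcB ▸ hxc⟩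
          exact ⟨_, ⟨Finset.ne_empty_of_mem hx, Or.inl rfl⟩, hx⟩
        · exact ⟨c, ⟨Finset.ne_empty_of_mem hxc, Or.inr ⟨hcB, hc⟩⟩, hxc⟩
    refine ⟨⟨⟨_, hP⟩, B.erase (k + 1), ?_⟩, Subtype.ext ?_⟩
    · by_cases he : B.erase (k + 1) = ∅ <;> simp [he]
    · have he : ∅ ∉ Q.erase B := fun he => hQ.empty_notMem (Finset.mem_of_mem_erase he)
      have hb : B.erase (k + 1) ∉ Q.erase B := fun hb => hbQ (Finset.mem_of_mem_erase hb)
      simp only [extend, adjoin]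
      rw [Finset.erase_right_comm, Finset.erase_insert hb, Finset.erase_eq_of_notMem he,
        Finset.insert_erase hkB, Finset.insert_erase hB]

theorem isSetPartition_zero_iff {P : Finset (Finset ℕ)} : IsSetPartition 0 P ↔ P = ∅ := by
  refine ⟨fun h => Finset.eq_empty_of_forall_notMem fun b hb => ?_, ?_⟩
  · obtain ⟨x, hx⟩ := h.1 b hb
    have := h.mem_Icc hb hx
    omega
  · rintro rfl
    simp [IsSetPartition]

instance SetPartition.finite (k : ℕ) : Finite (SetPartition k) := by
  induction k with
  | zero =>
    refine @Finite.of_subsingleton _ ⟨fun P Q => Subtype.ext ?_⟩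
    rw [isSetPartition_zero_iff.1 P.2, isSetPartition_zero_iff.1 Q.2]
  | succ k ih => exact Finite.of_surjective _ (extend_bijective k).2

theorem IsSetPartition.card_adjoin_empty {k : ℕ} {P : Finset (Finset ℕ)}
    (h : IsSetPartition k P) : (_root_.adjoin (k + 1) P ∅).card = P.card + 1 := by
  rw [_root_.adjoin, Finset.erase_eq_of_notMem h.empty_notMem,
    Finset.card_insert_of_notMem (h.insert_succ_notMem ∅)]

theorem IsSetPartition.card_adjoin_of_mem {k : ℕ} {P : Finset (Finset ℕ)}
    (h : IsSetPartition k P) {b : Finset ℕ} (hb : b ∈ P) :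
    (_root_.adjoin (k + 1) P b).card = P.card := by
  rw [_root_.adjoin, Finset.card_insert_of_notMem
    fun hm => h.insert_succ_notMem b (Finset.mem_of_mem_erase hm), Finset.card_erase_add_one hb]

noncomputable instance (k : ℕ) : Fintype (CompositionChain k) := Fintype.ofFinite _

noncomputable instance (k : ℕ) : Fintype (SetPartition k) := Fintype.ofFinite _

theorem CompositionChain.sum_succ (k : ℕ) (g : ℕ → ℕ) :
    ∑ c : CompositionChain (k + 1), g c.last.length =
      ∑ c : CompositionChain k, (g (c.last.length + 1) + c.last.length * g c.last.length) := by
  rw [← (extend_bijective k).sum_comp, Fintype.sum_sigma]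
  refine Finset.sum_congr rfl fun c _ => ?_
  simp [Fintype.sum_option, last_extend, successor]

theorem SetPartition.sum_succ (k : ℕ) (g : ℕ → ℕ) :
    ∑ P : SetPartition (k + 1), g P.1.card =
      ∑ P : SetPartition k, (g (P.1.card + 1) + P.1.card * g P.1.card) := by
  rw [← (extend_bijective k).sum_comp, Fintype.sum_sigma]
  refine Finset.sum_congr rfl fun P _ => ?_
  have hsub := Finset.sum_coe_sort (insert ∅ P.1) fun b => g (adjoin (k + 1) P.1 b).card
  refine hsub.trans ?_
  rw [Finset.sum_insert P.2.empty_notMem, P.2.card_adjoin_empty,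
    Finset.sum_congr rfl fun b hb => by rw [P.2.card_adjoin_of_mem hb]]
  simp

theorem sum_chain_length_eq_sum_partition_card (k : ℕ) (g : ℕ → ℕ) :
    ∑ c : CompositionChain k, g c.last.length = ∑ P : SetPartition k, g P.1.card := by
  induction k generalizing g with
  | zero =>
    rw [Fintype.sum_eq_single (⟨fun _ => [], rfl, fun i => i.elim0⟩ : CompositionChain 0),
      Fintype.sum_eq_single (⟨∅, isSetPartition_zero_iff.2 rfl⟩ : SetPartition 0)]
    · rfl
    · exact fun P hP => (hP (Subtype.ext (isSetPartition_zero_iff.1 P.2))).elim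
    · refine fun c hc => (hc (Subtype.ext (funext fun i => ?_))).elim
      rw [Fin.fin_one_eq_zero i, c.2.1]
  | succ k ih =>
    rw [CompositionChain.sum_succ, SetPartition.sum_succ]
    exact ih fun n => g (n + 1) + n * g n

/-- For every `k ≥ 0`, the total number of chains of length `k` starting at
the empty composition equals the number of set partitions of `[k]`
(the `k`-th Bell number). -/
theorem card_chains_eq_bell (k : ℕ) :
    Nat.card {c : Fin (k + 1) → List ℕ //
        c 0 = [] ∧ ∀ i : Fin k, Step (c i.castSucc) (c i.succ)}
      = Nat.card {P : Finset (Finset ℕ) // IsSetPartition k P} := by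
  have h := sum_chain_length_eq_sum_partition_card k fun _ => 1
  simpa [Nat.card_eq_fintype_card] using h
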